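/- Let A ⊆ ℕ^n be a finite set and let (S, β) be a reduced circuit on A. Then there exists K ∈ ℕ and a graded partition L_0, L_1, …, L_K of (A ∩ (2ℕ)^n) ∪ {β} such that L_0 = S ∪ {β}, the sets L_0, …, L_K are pairwise disjoint with union equal to (A ∩ (2ℕ)^n) ∪ {β}, and for every circuit (S', γ) on A with (S', γ) ≠ (S, β), |S'| > 1 and γ ∈ (A ∩ (2ℕ)^n) ∪ {β}, there exist indices i < j and a point α ∈ S' with γ ∈ L_i and α ∈ L_j. -/

import Mathlib

open MvPolynomial Finset

/-- A lattice exponent is even if every entry is even. -/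
def IsEvenPt {n : ℕ} (α : Fin n →₀ ℕ) : Prop := ∀ i, Even (α i)

/-- The embedding of a lattice exponent into `ℝⁿ`. -/
def toR {n : ℕ} (α : Fin n →₀ ℕ) : Fin n → ℝ := fun i => (α i : ℝ)

/-- `(S, β)` is a (simplicial) circuit on the ground set `A`:
`S ⊆ A ∩ (2ℕ)ⁿ` is affinely independent and `β ∈ A` lies in the relative
interior of `conv S`. -/
structure IsCircuitOn {n : ℕ} (A : Finset (Fin n →₀ ℕ)) (S : Finset (Fin n →₀ ℕ))
    (β : Fin n →₀ ℕ) : Prop where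
  subset : S ⊆ A
  even_mem : ∀ α ∈ S, IsEvenPt α
  beta_mem : β ∈ A
  indep : AffineIndependent ℝ (fun α : S => toR (α : Fin n →₀ ℕ))
  relint : toR β ∈ intrinsicInterior ℝ (convexHull ℝ (toR '' (S : Set (Fin n →₀ ℕ))))

/-- `lam` gives the barycentric coordinates of `β` with respect to `S`. -/
def IsBarycentric {n : ℕ} (S : Finset (Fin n →₀ ℕ)) (β : Fin n →₀ ℕ)
    (lam : (Fin n →₀ ℕ) → ℝ) : Prop :=
  (∀ α ∈ S, 0 < lam α) ∧ ∑ α ∈ S, lam α = 1 ∧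
    ∀ i, (β i : ℝ) = ∑ α ∈ S, lam α * (α i : ℝ)

/-- The circuit number `Θ = ∏_{α ∈ S} (c_α / λ_α) ^ (λ_α)`. -/
noncomputable def circuitNumber {n : ℕ} (S : Finset (Fin n →₀ ℕ))
    (c lam : (Fin n →₀ ℕ) → ℝ) : ℝ :=
  ∏ α ∈ S, (c α / lam α) ^ (lam α)

/-- The circuit polynomial `∑_{α ∈ S} c_α x^α + d x^β`. -/
noncomputable def circuitPoly {n : ℕ} (S : Finset (Fin n →₀ ℕ)) (β : Fin n →₀ ℕ)
    (c : (Fin n →₀ ℕ) → ℝ) (d : ℝ) : MvPolynomial (Fin n) ℝ :=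
  (∑ α ∈ S, monomial α (c α)) + monomial β d

/-- Generators of the SONC cone on `A`: nonnegative circuit polynomials on circuits
on `A`, together with monomial squares `x^α`, `α ∈ A ∩ (2ℕ)ⁿ`. -/
def SONCGen {n : ℕ} (A : Finset (Fin n →₀ ℕ)) : Set (MvPolynomial (Fin n) ℝ) :=
  {f | (∃ S β c d, IsCircuitOn A S β ∧ (∀ α ∈ S, 0 < c α) ∧
          f = circuitPoly S β c d ∧ ∀ x : Fin n → ℝ, 0 ≤ eval x f) ∨
       (∃ α ∈ A, IsEvenPt α ∧ f = monomial α 1)}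

/-- The SONC cone on `A`: all finite nonnegative combinations of the generators. -/
def SONCCone {n : ℕ} (A : Finset (Fin n →₀ ℕ)) : Set (MvPolynomial (Fin n) ℝ) :=
  {f | ∃ (k : ℕ) (g : Fin k → MvPolynomial (Fin n) ℝ) (μ : Fin k → ℝ),
        (∀ i, g i ∈ SONCGen A ∧ 0 ≤ μ i) ∧ f = ∑ i, μ i • g i}

/-- The ray `ℝ₊ · f`. -/
def raySet {n : ℕ} (f : MvPolynomial (Fin n) ℝ) : Set (MvPolynomial (Fin n) ℝ) :=
  {p | ∃ t : ℝ, 0 ≤ t ∧ p = t • f}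

/-- `ℝ₊ · f` is an extreme ray of the convex cone `K`. -/
def IsExtremeRay {n : ℕ} (K : Set (MvPolynomial (Fin n) ℝ))
    (f : MvPolynomial (Fin n) ℝ) : Prop :=
  f ≠ 0 ∧ f ∈ K ∧ ∀ g h, g ∈ K → h ∈ K → f = g + h → g ∈ raySet f ∧ h ∈ raySet f

/-- The ray `ℝ₊ · f` is an exposed face of `K`: some linear functional vanishes on
the ray and is strictly positive on the rest of `K`. -/
def IsExposedRay {n : ℕ} (K : Set (MvPolynomial (Fin n) ℝ))
    (f : MvPolynomial (Fin n) ℝ) : Prop :=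
  ∃ l : MvPolynomial (Fin n) ℝ →ₗ[ℝ] ℝ,
    (∀ p ∈ raySet f, l p = 0) ∧ ∀ g ∈ K \ raySet f, 0 < l g

/-- `(S, β)` is a reduced circuit on `A`: the only even points of `A` in `conv S`
are those of `S ∪ {β}`. -/
def IsReducedCircuitOn {n : ℕ} (A : Finset (Fin n →₀ ℕ)) (S : Finset (Fin n →₀ ℕ))
    (β : Fin n →₀ ℕ) : Prop :=
  IsCircuitOn A S β ∧
    {γ : Fin n →₀ ℕ | γ ∈ A ∧ IsEvenPt γ ∧
        toR γ ∈ convexHull ℝ (toR '' (S : Set (Fin n →₀ ℕ)))} =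
      {γ : Fin n →₀ ℕ | (γ ∈ S ∨ γ = β) ∧ IsEvenPt γ}

lemma toR_injective {n : ℕ} : Function.Injective (toR : (Fin n →₀ ℕ) → Fin n → ℝ) := by
  intro a b h
  ext i
  exact Nat.cast_injective (R := ℝ) (congrFun h i)

lemma mem_convexHull_toR {n : ℕ} {S : Finset (Fin n →₀ ℕ)} {x : Fin n → ℝ} :
    x ∈ convexHull ℝ (toR '' (S : Set (Fin n →₀ ℕ))) ↔
      ∃ w : (Fin n →₀ ℕ) → ℝ,
        (∀ α ∈ S, 0 ≤ w α) ∧ ∑ α ∈ S, w α = 1 ∧ ∑ α ∈ S, w α • toR α = x := by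
  classical
  constructor
  · intro hx
    rw [← Finset.coe_image, Finset.mem_convexHull'] at hx
    obtain ⟨w, hw, h1, h2⟩ := hx
    rw [Finset.sum_image toR_injective.injOn] at h1 h2
    exact ⟨w ∘ toR, fun α hα => hw _ (Finset.mem_image_of_mem _ hα), h1, h2⟩
  · rintro ⟨w, hw, h1, rfl⟩
    exact (convex_convexHull ℝ _).sum_mem hw h1
      fun α hα => subset_convexHull ℝ _ (Set.mem_image_of_mem _ hα)

/-- A relative interior point of a set lies strictly between any given point of the set and
some other point of the set. -/
lemma exists_mem_openSegment_of_mem_intrinsicInterior {n : ℕ} {s : Set (Fin n → ℝ)}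
    {x y : Fin n → ℝ} (hx : x ∈ intrinsicInterior ℝ s) (hy : y ∈ s) :
    ∃ z ∈ s, x ∈ openSegment ℝ y z := by
  obtain ⟨p, hp, rfl⟩ := mem_intrinsicInterior.1 hx
  have hys : y ∈ affineSpan ℝ s := subset_affineSpan ℝ s hy
  let g : ℝ → affineSpan ℝ s := fun t =>
    ⟨AffineMap.lineMap y (p : Fin n → ℝ) t, AffineMap.lineMap_mem t hys p.2⟩
  have hg : Continuous g := by
    refine Continuous.subtype_mk ?_ _
    exact AffineMap.lineMap_continuous
  have hg1 : g 1 = p := Subtype.ext (by simp [g])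
  have hnhds : ∀ᶠ t in nhds (1 : ℝ), g t ∈ interior ((↑) ⁻¹' s : Set (affineSpan ℝ s)) :=
    hg.continuousAt.eventually_mem (by rw [hg1]; exact isOpen_interior.mem_nhds hp)
  obtain ⟨ε, hε, hball⟩ := Metric.eventually_nhds_iff.1 hnhds
  have ht := interior_subset (hball (y := 1 + ε / 2)
    (by rw [Real.dist_eq, add_sub_cancel_left, abs_of_pos (by positivity)]; linarith))
  refine ⟨_, ht, (ε / 2) / (1 + ε / 2), 1 / (1 + ε / 2), by positivity, by positivity, ?_, ?_⟩
  · field_simp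
    ring
  · simp only [g, AffineMap.lineMap_apply_module]
    ext i
    simp only [Pi.add_apply, Pi.smul_apply, smul_eq_mul]
    field_simp
    ring

lemma AffineIndependent.eq_of_sum_toR_eq {n : ℕ} {S : Finset (Fin n →₀ ℕ)}
    (hS : AffineIndependent ℝ (fun α : S => toR (α : Fin n →₀ ℕ)))
    {u v : (Fin n →₀ ℕ) → ℝ} (h1 : ∑ α ∈ S, u α = ∑ α ∈ S, v α)
    (h2 : ∑ α ∈ S, u α • toR α = ∑ α ∈ S, v α • toR α) {α : Fin n →₀ ℕ} (hα : α ∈ S) :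
    u α = v α := by
  have h := affineIndependent_iff.1 hS Finset.univ (fun a => u a - v a)
    (by
      rw [Finset.sum_coe_sort S (fun a => u a - v a), Finset.sum_sub_distrib, h1, sub_self])
    (by
      rw [Finset.sum_coe_sort S (fun a => (u a - v a) • toR a)]
      simp only [sub_smul]
      rw [Finset.sum_sub_distrib, h2, sub_self])
  exact sub_eq_zero.1 (h ⟨α, hα⟩ (Finset.mem_univ _))

/-- The vertices of a simplex are extreme points. -/
lemma AffineIndependent.eq_of_toR_mem_openSegment {n : ℕ} {S : Finset (Fin n →₀ ℕ)}
    (hS : AffineIndependent ℝ (fun α : S => toR (α : Fin n →₀ ℕ)))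
    {s : Fin n →₀ ℕ} (hs : s ∈ S) {y z : Fin n → ℝ}
    (hy : y ∈ convexHull ℝ (toR '' (S : Set (Fin n →₀ ℕ))))
    (hz : z ∈ convexHull ℝ (toR '' (S : Set (Fin n →₀ ℕ))))
    (h : toR s ∈ openSegment ℝ y z) : y = toR s := by
  classical
  obtain ⟨u, hu, hu1, rfl⟩ := mem_convexHull_toR.1 hy
  obtain ⟨v, hv, hv1, rfl⟩ := mem_convexHull_toR.1 hz
  obtain ⟨a, b, ha, hb, hab, h⟩ := h
  have key : ∀ α ∈ S, a * u α + b * v α = if α = s then 1 else 0 := by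
    intro α hα
    refine hS.eq_of_sum_toR_eq (u := fun α => a * u α + b * v α)
      (v := fun α => if α = s then 1 else 0) ?_ ?_ hα
    · simp [Finset.sum_add_distrib, ← Finset.mul_sum, hu1, hv1, hab, hs]
    · simp [add_smul, mul_smul, Finset.sum_add_distrib, ← Finset.smul_sum, h, hs]
  have hzero : ∀ α ∈ S, α ≠ s → u α = 0 := by
    intro α hα hne
    have := key α hα
    rw [if_neg hne] at this
    nlinarith [mul_nonneg ha.le (hu α hα), mul_nonneg hb.le (hv α hα)]
  rw [Finset.sum_eq_single_of_mem s hs fun α hα hne => hzero α hα hne] at hu1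
  rw [Finset.sum_eq_single_of_mem s hs fun α hα hne => by rw [hzero α hα hne, zero_smul],
    hu1, one_smul]

/-- The inner point of a circuit is a convex combination of the outer points with positive
weights. -/
lemma IsCircuitOn.exists_pos_weights {n : ℕ} {A S : Finset (Fin n →₀ ℕ)} {β : Fin n →₀ ℕ}
    (h : IsCircuitOn A S β) :
    ∃ w : (Fin n →₀ ℕ) → ℝ,
      (∀ α ∈ S, 0 < w α) ∧ ∑ α ∈ S, w α = 1 ∧ ∑ α ∈ S, w α • toR α = toR β := by
  have hβ := intrinsicInterior_subset h.relint
  have hne : S.Nonempty := by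
    rw [Finset.nonempty_iff_ne_empty]
    rintro rfl
    simp at hβ
  have hcard : (0 : ℝ) < S.card := by exact_mod_cast hne.card_pos
  have hc : ∑ α ∈ S, (S.card : ℝ)⁻¹ • toR α ∈
      convexHull ℝ (toR '' (S : Set (Fin n →₀ ℕ))) :=
    mem_convexHull_toR.2 ⟨fun _ => (S.card : ℝ)⁻¹, fun _ _ => by positivity,
      by simp [hcard.ne'], rfl⟩
  obtain ⟨z, hz, a, b, ha, hb, hab, hsum⟩ :=
    exists_mem_openSegment_of_mem_intrinsicInterior h.relint hc
  obtain ⟨v, hv, hv1, rfl⟩ := mem_convexHull_toR.1 hz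
  refine ⟨fun α => a * (S.card : ℝ)⁻¹ + b * v α, fun α hα => ?_, ?_, ?_⟩
  · have := mul_nonneg hb.le (hv α hα)
    positivity
  · simp [Finset.sum_add_distrib, ← Finset.mul_sum, hv1]
    field_simp
    linarith
  · rw [← hsum]
    simp only [add_smul, mul_smul, Finset.sum_add_distrib, Finset.smul_sum]

/-- Jensen's inequality for the distance to a compact convex set. -/
lemma infDist_sum_le {n : ℕ} {C : Set (Fin n → ℝ)} (hC : Convex ℝ C) (hcomp : IsCompact C)
    (hne : C.Nonempty) {ι : Type*} (T : Finset ι) (w : ι → ℝ) (p : ι → Fin n → ℝ)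
    (hw : ∀ i ∈ T, 0 ≤ w i) (hw1 : ∑ i ∈ T, w i = 1) :
    Metric.infDist (∑ i ∈ T, w i • p i) C ≤ ∑ i ∈ T, w i * Metric.infDist (p i) C := by
  choose c hcC hc using fun x => hcomp.exists_infDist_eq_dist hne x
  calc Metric.infDist (∑ i ∈ T, w i • p i) C
      ≤ dist (∑ i ∈ T, w i • p i) (∑ i ∈ T, w i • c (p i)) :=
        Metric.infDist_le_dist_of_mem (hC.sum_mem hw hw1 fun i _ => hcC _)
    _ ≤ ∑ i ∈ T, dist (w i • p i) (w i • c (p i)) := dist_sum_sum_le _ _ _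
    _ = ∑ i ∈ T, w i * Metric.infDist (p i) C := by
        refine Finset.sum_congr rfl fun i hi => ?_
        rw [dist_smul₀, Real.norm_of_nonneg (hw i hi), ← hc]

/-- A strict convex combination of at least two distinct points has sum of squares below the
largest sum of squares of these points. -/
lemma exists_sum_sq_lt {n : ℕ} {T : Finset (Fin n →₀ ℕ)} {γ : Fin n →₀ ℕ}
    {w : (Fin n →₀ ℕ) → ℝ} (hw : ∀ α ∈ T, 0 < w α) (hw1 : ∑ α ∈ T, w α = 1)
    (hγ : ∑ α ∈ T, w α • toR α = toR γ) (hT : 1 < T.card) :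
    ∃ α ∈ T, ∑ i, toR γ i ^ 2 < ∑ i, toR α i ^ 2 := by
  by_contra! hle
  obtain ⟨δ, hδ, hδγ⟩ := Finset.exists_mem_ne hT γ
  have hcoord : ∀ i, ∑ α ∈ T, w α * toR α i = toR γ i := fun i => by
    simpa using congrFun hγ i
  have hexp : ∑ α ∈ T, w α * ∑ i, (toR α i - toR γ i) ^ 2 =
      ∑ α ∈ T, w α * ∑ i, toR α i ^ 2 - ∑ i, toR γ i ^ 2 := by
    have h1 : ∀ i, ∑ α ∈ T, w α * (toR α i - toR γ i) ^ 2 =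
        ∑ α ∈ T, w α * toR α i ^ 2 - toR γ i ^ 2 := by
      intro i
      have : ∀ α ∈ T, w α * (toR α i - toR γ i) ^ 2 =
          w α * toR α i ^ 2 - 2 * toR γ i * (w α * toR α i) + toR γ i ^ 2 * w α :=
        fun α _ => by ring
      rw [Finset.sum_congr rfl this, Finset.sum_add_distrib, Finset.sum_sub_distrib,
        ← Finset.mul_sum, ← Finset.mul_sum, hcoord, hw1]
      ring
    simp only [Finset.mul_sum]
    rw [Finset.sum_comm, Finset.sum_congr rfl fun i _ => h1 i, Finset.sum_sub_distrib,
      Finset.sum_comm]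
  have hup : ∑ α ∈ T, w α * ∑ i, toR α i ^ 2 ≤ ∑ i, toR γ i ^ 2 := by
    calc ∑ α ∈ T, w α * ∑ i, toR α i ^ 2
        ≤ ∑ α ∈ T, w α * ∑ i, toR γ i ^ 2 :=
          Finset.sum_le_sum fun α hα => mul_le_mul_of_nonneg_left (hle α hα) (hw α hα).le
      _ = ∑ i, toR γ i ^ 2 := by rw [← Finset.sum_mul, hw1, one_mul]
  have hpos : 0 < ∑ α ∈ T, w α * ∑ i, (toR α i - toR γ i) ^ 2 := by
    refine Finset.sum_pos' (fun α hα => mul_nonneg (hw α hα).le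
      (Finset.sum_nonneg fun i _ => sq_nonneg _)) ⟨δ, hδ, mul_pos (hw δ hδ) ?_⟩
    obtain ⟨i, hi⟩ := Function.ne_iff.1 (toR_injective.ne hδγ)
    exact Finset.sum_pos' (fun i _ => sq_nonneg _)
      ⟨i, Finset.mem_univ _, by have := sub_ne_zero.2 hi; positivity⟩
  linarith

/-- Every circuit other than `(S, β)` with inner point in `S ∪ {β}` and at least two outer points
has an outer point outside `S ∪ {β}`. -/
lemma IsCircuitOn.exists_notMem_of_inner_mem {n : ℕ} {A S S' : Finset (Fin n →₀ ℕ)}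
    {β γ : Fin n →₀ ℕ} (h : IsCircuitOn A S β) (h' : IsCircuitOn A S' γ)
    (hne : (S', γ) ≠ (S, β)) (hcard : 1 < S'.card) (hγ : γ ∈ S ∪ {β}) :
    ∃ α ∈ S', α ∉ S ∪ {β} := by
  classical
  by_contra! hsub
  have hβC := intrinsicInterior_subset h.relint
  have hmemC : ∀ α ∈ S', toR α ∈ convexHull ℝ (toR '' (S : Set (Fin n →₀ ℕ))) := by
    intro α hα
    rcases Finset.mem_union.1 (hsub α hα) with hα | hα
    · exact subset_convexHull ℝ _ (Set.mem_image_of_mem _ hα)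
    · rwa [Finset.mem_singleton.1 hα]
  have hconv : convexHull ℝ (toR '' (S' : Set (Fin n →₀ ℕ))) ⊆
      convexHull ℝ (toR '' (S : Set (Fin n →₀ ℕ))) :=
    convexHull_min (by rintro _ ⟨α, hα, rfl⟩; exact hmemC α hα) (convex_convexHull ℝ _)
  obtain ⟨δ, hδ, hδγ⟩ := Finset.exists_mem_ne hcard γ
  have hδC' : toR δ ∈ convexHull ℝ (toR '' (S' : Set (Fin n →₀ ℕ))) :=
    subset_convexHull ℝ _ (Set.mem_image_of_mem _ hδ)
  obtain ⟨z, hz, hseg⟩ := exists_mem_openSegment_of_mem_intrinsicInterior h'.relint hδC'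
  have hγS : γ ∉ S := fun hγS =>
    hδγ (toR_injective (h.indep.eq_of_toR_mem_openSegment hγS (hconv hδC') (hconv hz) hseg))
  have hγS' : γ ∉ S' := fun hγS' =>
    hδγ (toR_injective (h'.indep.eq_of_toR_mem_openSegment hγS' hδC' hz hseg))
  obtain rfl : γ = β := by simpa [hγS] using hγ
  have hS'S : S' ⊆ S := by
    intro α hα
    rcases Finset.mem_union.1 (hsub α hα) with hα' | hα'
    · exact hα'
    · exact absurd (Finset.mem_singleton.1 hα' ▸ hα) hγS'
  refine hne (Prod.ext (hS'S.antisymm fun s hs => ?_) rfl)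
  by_contra hs'
  obtain ⟨w, hw, hw1, hwγ⟩ := h.exists_pos_weights
  obtain ⟨v, hv, hv1, hvγ⟩ := h'.exists_pos_weights
  have := h.indep.eq_of_sum_toR_eq (u := w) (v := fun α => if α ∈ S' then v α else 0)
    (by
      rw [hw1, ← Finset.sum_filter, Finset.filter_mem_eq_inter,
        Finset.inter_eq_right.2 hS'S, hv1])
    (by
      simp only [ite_smul, zero_smul]
      rw [hwγ, ← Finset.sum_filter, Finset.filter_mem_eq_inter,
        Finset.inter_eq_right.2 hS'S, hvγ]) hs
  rw [if_neg hs'] at this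
  exact (hw s hs).ne' this

/-- A finite set is graded by the rank function of any map to a linear order. -/
lemma Finset.card_filter_lt_strictMono {ι κ : Type*} [LinearOrder κ] (E : Finset ι) (k : ι → κ)
    {a b : ι} (ha : a ∈ E) (hab : k a < k b) :
    #{x ∈ E | k x < k a} < #{x ∈ E | k x < k b} := by
  refine Finset.card_lt_card (Finset.ssubset_iff_of_subset ?_ |>.2 ⟨a, ?_, ?_⟩)
  · exact Finset.monotone_filter_right _ fun x _ hx => lt_trans hx hab
  · simp [ha, hab]
  · simp

open Classical in
/-- The points of `C` come first; the others are ordered by distance to `C`, then by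
sum of squares. -/
noncomputable def gradingKey {n : ℕ} (C : Set (Fin n → ℝ)) (α : Fin n →₀ ℕ) : ℝ ×ₗ ℝ :=
  toLex (Metric.infDist (toR α) C, if toR α ∈ C then 0 else ∑ i, toR α i ^ 2)

lemma gradingKey_of_mem {n : ℕ} {C : Set (Fin n → ℝ)} {α : Fin n →₀ ℕ} (h : toR α ∈ C) :
    gradingKey C α = toLex (0, 0) := by
  rw [gradingKey, if_pos h, Metric.infDist_zero_of_mem h]

lemma gradingKey_zero_lt {n : ℕ} {C : Set (Fin n → ℝ)} (hC : IsClosed C) (hne : C.Nonempty)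
    {α : Fin n →₀ ℕ} (h : toR α ∉ C) : toLex (0, 0) < gradingKey C α :=
  Prod.Lex.toLex_lt_toLex.2 (Or.inl ((hC.notMem_iff_infDist_pos hne).1 h))

lemma gradingKey_zero_le {n : ℕ} {C : Set (Fin n → ℝ)} (hC : IsClosed C) (hne : C.Nonempty)
    (α : Fin n →₀ ℕ) : toLex (0, 0) ≤ gradingKey C α := by
  by_cases h : toR α ∈ C
  · rw [gradingKey_of_mem h]
  · exact (gradingKey_zero_lt hC hne h).le

lemma IsCircuitOn.exists_gradingKey_lt {n : ℕ} {A T : Finset (Fin n →₀ ℕ)} {γ : Fin n →₀ ℕ}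
    (h : IsCircuitOn A T γ) (hT : 1 < T.card) {C : Set (Fin n → ℝ)} (hC : Convex ℝ C)
    (hcomp : IsCompact C) (hne : C.Nonempty) (hγC : toR γ ∉ C) :
    ∃ α ∈ T, gradingKey C γ < gradingKey C α := by
  obtain ⟨w, hw, hw1, hwγ⟩ := h.exists_pos_weights
  by_contra! hle
  have hdist : ∀ α ∈ T, Metric.infDist (toR α) C ≤ Metric.infDist (toR γ) C := by
    intro α hα
    rcases Prod.Lex.toLex_le_toLex.1 (hle α hα) with h | h
    · exact h.le
    · exact h.1.le
  have hjensen := infDist_sum_le hC hcomp hne T w toR (fun α hα => (hw α hα).le) hw1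
  rw [hwγ] at hjensen
  have hconst : ∀ α ∈ T, w α * Metric.infDist (toR α) C = w α * Metric.infDist (toR γ) C := by
    have hterm : ∀ α ∈ T, w α * Metric.infDist (toR α) C ≤ w α * Metric.infDist (toR γ) C :=
      fun α hα => mul_le_mul_of_nonneg_left (hdist α hα) (hw α hα).le
    refine (Finset.sum_eq_sum_iff_of_le hterm).1 (le_antisymm (Finset.sum_le_sum hterm) ?_)
    rwa [← Finset.sum_mul, hw1, one_mul]
  obtain ⟨α, hα, hlt⟩ := exists_sum_sq_lt hw hw1 hwγ hT
  have heq := mul_left_cancel₀ (hw α hα).ne' (hconst α hα)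
  have hαC : toR α ∉ C := by
    rw [hcomp.isClosed.notMem_iff_infDist_pos hne, heq,
      ← hcomp.isClosed.notMem_iff_infDist_pos hne]
    exact hγC
  refine (hle α hα).not_gt (Prod.Lex.toLex_lt_toLex.2 (Or.inr ⟨heq.symm, ?_⟩))
  simpa only [if_neg hαC, if_neg hγC] using hlt

/-- **Graded partition of the ground set.** For a reduced circuit `(S, β)` on `A`
there is a partition `L_0, …, L_K` of `(A ∩ (2ℕ)ⁿ) ∪ {β}` with `L_0 = S ∪ {β}` such
that every other circuit `(S', γ)` on `A` with `|S'| > 1` and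
`γ ∈ (A ∩ (2ℕ)ⁿ) ∪ {β}` has `γ ∈ L_i` and some `α ∈ S'` in `L_j` with `i < j`. -/
theorem exists_graded_partition {n : ℕ} (A : Finset (Fin n →₀ ℕ))
    (S : Finset (Fin n →₀ ℕ)) (β : Fin n →₀ ℕ) (hred : IsReducedCircuitOn A S β) :
    ∃ (K : ℕ) (L : ℕ → Finset (Fin n →₀ ℕ)),
      L 0 = S ∪ {β} ∧
      (∀ i j, i ≤ K → j ≤ K → i ≠ j → Disjoint (L i) (L j)) ∧
      (∀ γ : Fin n →₀ ℕ, ((γ ∈ A ∧ IsEvenPt γ) ∨ γ = β) ↔ ∃ i ≤ K, γ ∈ L i) ∧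
      (∀ (S' : Finset (Fin n →₀ ℕ)) (γ : Fin n →₀ ℕ), IsCircuitOn A S' γ →
        (S', γ) ≠ (S, β) → 1 < S'.card → ((γ ∈ A ∧ IsEvenPt γ) ∨ γ = β) →
        ∃ i j α, i < j ∧ j ≤ K ∧ γ ∈ L i ∧ α ∈ S' ∧ α ∈ L j) := by
  classical
  obtain ⟨hcirc, hinter⟩ := hred
  set C : Set (Fin n → ℝ) := convexHull ℝ (toR '' (S : Set (Fin n →₀ ℕ))) with hCdef
  have hconv : Convex ℝ C := convex_convexHull ℝ _
  have hcomp : IsCompact C := (S.finite_toSet.image toR).isCompact_convexHull ℝ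
  have hβC : toR β ∈ C := intrinsicInterior_subset hcirc.relint
  have hne : C.Nonempty := ⟨_, hβC⟩
  let E : Finset (Fin n →₀ ℕ) := {γ ∈ A | IsEvenPt γ ∨ γ = β}
  have hE : ∀ γ, γ ∈ E ↔ (γ ∈ A ∧ IsEvenPt γ) ∨ γ = β := by
    intro γ
    simp only [E, Finset.mem_filter]
    constructor
    · tauto
    · rintro (h | rfl)
      · tauto
      · exact ⟨hcirc.beta_mem, Or.inr rfl⟩
  have hSC : ∀ γ ∈ S ∪ {β}, toR γ ∈ C := by
    intro γ hγ
    rcases Finset.mem_union.1 hγ with hγ | hγ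
    · exact subset_convexHull ℝ _ (Set.mem_image_of_mem _ hγ)
    · rwa [Finset.mem_singleton.1 hγ]
  have hEC : ∀ γ ∈ E, toR γ ∈ C → γ ∈ S ∪ {β} := by
    intro γ hγ hγC
    rcases (hE γ).1 hγ with h | rfl
    · have : γ ∈ {γ : Fin n →₀ ℕ | (γ ∈ S ∨ γ = β) ∧ IsEvenPt γ} := by
        rw [← hinter]
        exact ⟨h.1, h.2, hγC⟩
      exact Finset.mem_union.2 (this.1.imp_right Finset.mem_singleton.2)
    · simp
  have hSE : S ∪ {β} ⊆ E := by
    intro γ hγ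
    rw [hE]
    rcases Finset.mem_union.1 hγ with hγ | hγ
    · exact Or.inl ⟨hcirc.subset hγ, hcirc.even_mem γ hγ⟩
    · exact Or.inr (Finset.mem_singleton.1 hγ)
  let level : (Fin n →₀ ℕ) → ℕ := fun γ => #{x ∈ E | gradingKey C x < gradingKey C γ}
  have hlevel : ∀ {a b}, a ∈ E → gradingKey C a < gradingKey C b → level a < level b :=
    fun ha hab => Finset.card_filter_lt_strictMono E (gradingKey C) ha hab
  have hlevel_le : ∀ γ, level γ ≤ E.card := fun γ => Finset.card_filter_le _ _
  have hlevel_zero : ∀ γ, toR γ ∈ C → level γ = 0 := by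
    intro γ hγ
    refine Finset.card_eq_zero.2 (Finset.filter_eq_empty_iff.2 fun x _ => ?_)
    rw [gradingKey_of_mem hγ]
    exact (gradingKey_zero_le hcomp.isClosed hne x).not_gt
  have hkey : ∀ {a b}, toR a ∈ C → toR b ∉ C → gradingKey C a < gradingKey C b := by
    intro a b ha hb
    rw [gradingKey_of_mem ha]
    exact gradingKey_zero_lt hcomp.isClosed hne hb
  refine ⟨E.card, fun i => {γ ∈ E | level γ = i}, ?_, ?_, ?_, ?_⟩
  · ext γ
    rw [Finset.mem_filter]
    constructor
    · rintro ⟨hγ, h0⟩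
      refine hEC γ hγ ?_
      by_contra hγC
      have := hlevel (hSE (by simp)) (hkey hβC hγC)
      omega
    · exact fun hγ => ⟨hSE hγ, hlevel_zero γ (hSC γ hγ)⟩
  · intro i j _ _ hij
    refine Finset.disjoint_left.2 fun γ hi hj => hij ?_
    rw [← (Finset.mem_filter.1 hi).2, (Finset.mem_filter.1 hj).2]
  · intro γ
    rw [← hE]
    exact ⟨fun h => ⟨level γ, hlevel_le γ, Finset.mem_filter.2 ⟨h, rfl⟩⟩,
      fun ⟨_, _, h⟩ => (Finset.mem_filter.1 h).1⟩
  · intro S' γ h' hne' hcard hγ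
    rw [← hE] at hγ
    have hS'E : ∀ α ∈ S', α ∈ E := fun α hα =>
      (hE α).2 (Or.inl ⟨h'.subset hα, h'.even_mem α hα⟩)
    obtain ⟨α, hα, hlt⟩ : ∃ α ∈ S', gradingKey C γ < gradingKey C α := by
      by_cases hγC : toR γ ∈ C
      · obtain ⟨α, hα, hαS⟩ :=
          hcirc.exists_notMem_of_inner_mem h' hne' hcard (hEC γ hγ hγC)
        exact ⟨α, hα, hkey hγC fun hαC => hαS (hEC α (hS'E α hα) hαC)⟩
      · exact h'.exists_gradingKey_lt hcard hconv hcomp hne hγC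
    exact ⟨level γ, level α, α, hlevel hγ hlt, hlevel_le α,
      Finset.mem_filter.2 ⟨hγ, rfl⟩, hα, Finset.mem_filter.2 ⟨hS'E α hα, rfl⟩⟩
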